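/- Let R be a commutative noetherian domain and let f : C → D be an injective homomorphism of flat R-coalgebras. Then every R-linear map φ : M → M' between R-torsion-free right C-comodules (M, ρ) and (M', ρ') which is a map of D-comodules via f (i.e. (id ⊗ f)∘ρ'∘φ = (φ ⊗ id_D)∘(id ⊗ f)∘ρ) is a map of C-comodules (i.e. ρ'∘φ = (φ ⊗ id_C)∘ρ). -/

import Mathlib

open TensorProduct LinearMap

/-- Tensoring an injective map of modules with flat source with a torsion-free module over a domain
preserves injectivity. -/
theorem lTensor_injective_of_noZeroSMulDivisors {R C D M : Type*} [CommRing R] [IsDomain R]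
    [AddCommGroup C] [Module R C] [Module.Flat R C] [AddCommGroup D] [Module R D]
    [AddCommGroup M] [Module R M] [NoZeroSMulDivisors R M]
    (f : C →ₗ[R] D) (hf : Function.Injective f) : Function.Injective (lTensor M f) := by
  let K := FractionRing R
  let i : M →ₗ[R] K ⊗[R] M := TensorProduct.mk R K M 1
  have hi : Function.Injective i := by
    have : IsLocalizedModule (nonZeroDivisors R) i :=
      (isLocalizedModule_iff_isBaseChange (nonZeroDivisors R) K i).2
        (TensorProduct.isBaseChange R M K)
    intro x y h
    obtain ⟨c, hc⟩ := (IsLocalizedModule.eq_iff_exists (nonZeroDivisors R) i).1 h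
    exact smul_right_injective M (nonZeroDivisors.ne_zero c.2) hc
  have : Module.Flat R (K ⊗[R] M) :=
    have : Module.Flat R K := IsLocalization.flat K (nonZeroDivisors R)
    Module.Flat.trans R K (K ⊗[R] M)
  have h : Function.Injective (rTensor D i ∘ₗ lTensor M f) := by
    rw [rTensor_comp_lTensor, ← lTensor_comp_rTensor]
    exact (Module.Flat.lTensor_preserves_injective_linearMap f hf).comp
      (Module.Flat.rTensor_preserves_injective_linearMap i hi)
  exact Function.Injective.of_comp h

/-- **Proposition 9b (1), fullness.** Let `R` be a commutative noetherian domain and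
`f : C → D` an injective homomorphism of flat `R`-coalgebras.  Then every `R`-linear
map `φ : M → M'` between `R`-torsion-free right `C`-comodules which is a map of
`D`-comodules via `f` (i.e. `(id ⊗ f) ∘ ρ' ∘ φ = (φ ⊗ f) ∘ ρ`) is a map of
`C`-comodules (i.e. `ρ' ∘ φ = (φ ⊗ id_C) ∘ ρ`). -/
theorem statement16 (R C D : Type) [CommRing R] [IsDomain R] [IsNoetherianRing R]
    [AddCommGroup C] [Module R C] [Coalgebra R C] [Module.Flat R C]
    [AddCommGroup D] [Module R D] [Coalgebra R D] [Module.Flat R D]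
    (f : C →ₗc[R] D) (hf : Function.Injective f) :
    ∀ (M M' : Type) [AddCommGroup M] [Module R M] [NoZeroSMulDivisors R M]
      [AddCommGroup M'] [Module R M'] [NoZeroSMulDivisors R M'],
      ∀ (ρ : M →ₗ[R] M ⊗[R] C) (ρ' : M' →ₗ[R] M' ⊗[R] C),
        (∀ m : M, (TensorProduct.assoc R M C C) ((rTensor C ρ) (ρ m)) =
            (lTensor M (Coalgebra.comul : C →ₗ[R] C ⊗[R] C)) (ρ m)) →
        (∀ m : M, (TensorProduct.rid R M)
            ((lTensor M (Coalgebra.counit : C →ₗ[R] R)) (ρ m)) = m) →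
        (∀ m : M', (TensorProduct.assoc R M' C C) ((rTensor C ρ') (ρ' m)) =
            (lTensor M' (Coalgebra.comul : C →ₗ[R] C ⊗[R] C)) (ρ' m)) →
        (∀ m : M', (TensorProduct.rid R M')
            ((lTensor M' (Coalgebra.counit : C →ₗ[R] R)) (ρ' m)) = m) →
        ∀ φ : M →ₗ[R] M',
          (lTensor M' f.toLinearMap) ∘ₗ ρ' ∘ₗ φ = (TensorProduct.map φ f.toLinearMap) ∘ₗ ρ →
          ρ' ∘ₗ φ = (TensorProduct.map φ (LinearMap.id : C →ₗ[R] C)) ∘ₗ ρ := by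
  intro M M' _ _ _ _ _ _ ρ ρ' _ _ _ _ φ h
  have hinj := lTensor_injective_of_noZeroSMulDivisors (M := M') f.toLinearMap hf
  refine LinearMap.ext fun m => hinj ?_
  refine (LinearMap.congr_fun h m).trans ?_
  change _ = (lTensor M' f.toLinearMap ∘ₗ TensorProduct.map φ LinearMap.id) (ρ m)
  rw [lTensor_comp_map]
  rfl
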